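/- In the polynomial ring B_g[ξ, η] the following identity holds: ξ²η²·( 2ξ⁻¹ + 2η⁻¹ + 4Σ_{i=1}^{g} λ_{4i+2} ξⁱηⁱ + 2Σ_{i=0}^{g−1} λ_{4i+4} (ξ+η) ξⁱηⁱ − q(ξ,η) ) = (ξ−η)² · Σ_{i=1}^{g} Σ_{j=1}^{g} p_{2i−1,2j−1} ξⁱηʲ, where q(ξ,η) = 𝐛₂(ξ)𝐛₂(η) + (1−𝐛₁(ξ))𝐛₃(η) + 𝐛₃(ξ)(1−𝐛₁(η)) + 2(1−𝐛₁(ξ))(1−𝐛₁(η))(ξ⁻¹ + η⁻¹ + 4b_{1,1}); note that after multiplying out, ξ²η² times each term involving ξ⁻¹ or η⁻¹ is a polynomial, so the left-hand side lies in B_g[ξ, η]. In particular (ξ−η)² divides the left-hand side, the quotient has degree at most g in each of ξ and η, is symmetric in ξ and η, and its coefficients are the polynomials p_{2i−1,2j−1} from the elimination recursion (in particular the coefficient of ξⁱη is 2b_{1,2i−1}). -/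

import Mathlib

open MvPolynomial

noncomputable section

/-- B_g = ℂ[b_{i,j} : i ∈ {1,2,3}, j odd, 1 ≤ j ≤ 2g−1], as a polynomial ring in 3g variables;
the variable (i, m) : Fin 3 × Fin g stands for b_{i+1, 2m+1}. -/
abbrev Bg (g : ℕ) : Type := MvPolynomial (Fin 3 × Fin g) ℂ

/-- `bb g i m` is the variable b_{i, 2m−1} (zero if i ∉ {1,2,3} or m ∉ {1,…,g}). -/
noncomputable def bb (g : ℕ) (i m : ℕ) : Bg g :=
  if h : 1 ≤ i ∧ i ≤ 3 ∧ 1 ≤ m ∧ m ≤ g then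
    MvPolynomial.X (⟨i - 1, by omega⟩, ⟨m - 1, by omega⟩) else 0

/-- `bv g i j` is the variable b_{i,j} for odd j (zero for j > 2g−1). -/
noncomputable def bv (g : ℕ) (i j : ℕ) : Bg g :=
  if Odd j then bb g i ((j + 1) / 2) else 0

/-- `Qg g a c` is p_{2a−1, 2c−1} for 1 ≤ a ≤ c, by the elimination recursion. -/
noncomputable def Qg (g : ℕ) : ℕ → ℕ → Bg g
  | 0, _ => 0
  | 1, c => 2 * bb g 1 c
  | 2, c => 6 * bb g 1 1 * bb g 1 c - bb g 3 c + 6 * bb g 1 (c + 1)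
  | 3, c => bb g 3 1 * bb g 1 c - bb g 2 1 * bb g 2 c + bb g 1 1 * bb g 3 c
      - 2 * (4 * bb g 1 1 ^ 2 + bb g 1 2) * bb g 1 c
      + 10 * bb g 1 1 * bb g 1 (c + 1) - 2 * bb g 3 (c + 1) + 10 * bb g 1 (c + 2)
  | (a + 4), c => 2 * (if c + 1 ≤ g then Qg g (a + 3) (c + 1) else 0)
      - (if c + 2 ≤ g then Qg g (a + 2) (c + 2) else 0)
      - 8 * bb g 1 1 * bb g 1 (a + 2) * bb g 1 c - 2 * bb g 1 c * bb g 1 (a + 3)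
      - 2 * bb g 1 (a + 2) * bb g 1 (c + 1) + bb g 1 (a + 2) * bb g 3 c
      - bb g 2 (a + 2) * bb g 2 c + bb g 3 (a + 2) * bb g 1 c

/-- `pp g k l` is p_{k,l} for odd k, l (zero if k > 2g−1 or l > 2g−1). -/
noncomputable def pp (g : ℕ) (k l : ℕ) : Bg g :=
  if Odd k ∧ Odd l ∧ k ≤ 2 * g - 1 ∧ l ≤ 2 * g - 1 then
    if k ≤ l then Qg g ((k + 1) / 2) ((l + 1) / 2) else Qg g ((l + 1) / 2) ((k + 1) / 2)
  else 0

/-- 𝐛ᵢ(ξ) = Σ_{m=1}^{g} b_{i,2m−1} ξᵐ ∈ B_g[ξ]. -/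
noncomputable def Bcoef (g i : ℕ) : Polynomial (Bg g) :=
  ∑ m ∈ Finset.Icc 1 g, Polynomial.C (bb g i m) * Polynomial.X ^ m

/-- The polynomial ξ𝐛₂(ξ)² + 2ξ𝐛₃(ξ)(1 − 𝐛₁(ξ)) + 4(1 + 2b_{1,1}ξ)(1 − 𝐛₁(ξ))². -/
noncomputable def Fg (g : ℕ) : Polynomial (Bg g) :=
  Polynomial.X * (Bcoef g 2) ^ 2 + 2 * Polynomial.X * Bcoef g 3 * (1 - Bcoef g 1)
    + 4 * (1 + 2 * Polynomial.C (bb g 1 1) * Polynomial.X) * (1 - Bcoef g 1) ^ 2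

/-- `lam g m` is λ_{2m+2}, defined by 4λ_{2m+2} = coefficient of ξ^{m+1} in `Fg g`. -/
noncomputable def lam (g m : ℕ) : Bg g := ((1 : ℂ) / 4) • ((Fg g).coeff (m + 1))

/-- 𝐛ᵢ(ξ) as a polynomial in the two variables ξ = X 0, η = X 1 over B_g. -/
noncomputable def BX (g i : ℕ) : MvPolynomial (Fin 2) (Bg g) :=
  ∑ m ∈ Finset.Icc 1 g, MvPolynomial.C (bb g i m) * (MvPolynomial.X 0) ^ m

/-- 𝐛ᵢ(η). -/
noncomputable def BY (g i : ℕ) : MvPolynomial (Fin 2) (Bg g) :=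
  ∑ m ∈ Finset.Icc 1 g, MvPolynomial.C (bb g i m) * (MvPolynomial.X 1) ^ m

/-- The coefficient of `ξᵐηⁿ` of a polynomial in two variables. -/
def biCoeff {R : Type*} [CommRing R] (m n : ℕ) : MvPolynomial (Fin 2) R →ₗ[R] R :=
  MvPolynomial.lcoeff R (Finsupp.single 0 m + Finsupp.single 1 n)

section BiCoeff

variable {R : Type*} [CommRing R]

theorem single_add_single_eq_iff (m n : ℕ) (s : Fin 2 →₀ ℕ) :
    s = Finsupp.single 0 m + Finsupp.single 1 n ↔ s 0 = m ∧ s 1 = n := by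
  constructor
  · rintro rfl
    simp
  · rintro ⟨rfl, rfl⟩
    ext i
    fin_cases i <;> simp

theorem biCoeff_monomial (m n : ℕ) (s : Fin 2 →₀ ℕ) (a : R) :
    biCoeff m n (monomial s a) = if s 0 = m ∧ s 1 = n then a else 0 := by
  simp only [biCoeff, lcoeff_apply, coeff_monomial, single_add_single_eq_iff]

theorem monomial_eq_C_mul_pow_mul_pow (s : Fin 2 →₀ ℕ) (a : R) :
    monomial s a = C a * X 0 ^ s 0 * X 1 ^ s 1 := by
  rw [monomial_eq, Finsupp.prod_fintype _ _ (by simp), Fin.prod_univ_two, mul_assoc]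

theorem C_mul_pow_mul_pow_eq_monomial (m n : ℕ) (a : R) :
    C a * X 0 ^ m * X 1 ^ n
      = monomial (Finsupp.single 0 m + Finsupp.single 1 n : Fin 2 →₀ ℕ) a := by
  rw [monomial_eq_C_mul_pow_mul_pow]
  simp

theorem biCoeff_C_mul_pow_mul_pow (m n i j : ℕ) (a : R) :
    biCoeff m n (C a * X 0 ^ i * X 1 ^ j) = if i = m ∧ j = n then a else 0 := by
  rw [C_mul_pow_mul_pow_eq_monomial, biCoeff_monomial]
  simp

theorem biCoeff_pow_mul_pow_mul (m n i j : ℕ) (f : MvPolynomial (Fin 2) R) :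
    biCoeff m n (X 0 ^ i * X 1 ^ j * f)
      = if i ≤ m ∧ j ≤ n then biCoeff (m - i) (n - j) f else 0 := by
  induction f using MvPolynomial.induction_on' with
  | monomial s a =>
    have : X 0 ^ i * X 1 ^ j * monomial s a = C a * X 0 ^ (i + s 0) * X 1 ^ (j + s 1) := by
      rw [monomial_eq_C_mul_pow_mul_pow]
      ring
    rw [this, biCoeff_C_mul_pow_mul_pow, biCoeff_monomial, ← ite_and]
    congr 1
    exact propext (by omega)
  | add p q hp hq =>
    rw [mul_add, map_add, hp, hq, map_add]
    split_ifs <;> simp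

theorem biCoeff_aeval_mul_aeval (m n : ℕ) (u v : Polynomial R) :
    biCoeff m n (Polynomial.aeval (X 0) u * Polynomial.aeval (X 1) v)
      = u.coeff m * v.coeff n := by
  induction u using Polynomial.induction_on' with
  | add p q hp hq => simp only [map_add, add_mul, hp, hq, Polynomial.coeff_add]
  | monomial i a =>
    induction v using Polynomial.induction_on' with
    | add p q hp hq => simp only [map_add, mul_add, hp, hq, Polynomial.coeff_add]
    | monomial j b =>
      have : Polynomial.aeval (X 0 : MvPolynomial (Fin 2) R) (Polynomial.monomial i a)
          * Polynomial.aeval (X 1 : MvPolynomial (Fin 2) R) (Polynomial.monomial j b)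
          = C (a * b) * X 0 ^ i * X 1 ^ j := by
        simp only [Polynomial.aeval_monomial, MvPolynomial.algebraMap_eq, map_mul]
        ring
      rw [this, biCoeff_C_mul_pow_mul_pow, Polynomial.coeff_monomial, Polynomial.coeff_monomial,
        ite_and, ite_mul, mul_ite]
      simp

theorem biCoeff_rename_swap (m n : ℕ) (f : MvPolynomial (Fin 2) R) :
    biCoeff m n (rename (Equiv.swap 0 1) f) = biCoeff n m f := by
  induction f using MvPolynomial.induction_on' with
  | monomial s a =>
    have : rename (Equiv.swap 0 1) (monomial s a) = C a * X 0 ^ s 1 * X 1 ^ s 0 := by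
      rw [monomial_eq_C_mul_pow_mul_pow]
      simp only [map_mul, map_pow, rename_C, rename_X, Equiv.swap_apply_left,
        Equiv.swap_apply_right]
      ring
    rw [this, biCoeff_C_mul_pow_mul_pow, biCoeff_monomial]
    congr 1
    exact propext and_comm
  | add p q hp hq => rw [map_add, map_add, hp, hq, map_add]

theorem coeff_aeval_diagonal (k : ℕ) (f : MvPolynomial (Fin 2) R) :
    (aeval (fun _ => (Polynomial.X : Polynomial R)) f).coeff k
      = ∑ p ∈ Finset.HasAntidiagonal.antidiagonal k, biCoeff p.1 p.2 f := by
  induction f using MvPolynomial.induction_on' with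
  | monomial s a =>
    simp only [biCoeff_monomial]
    have : aeval (fun _ => (Polynomial.X : Polynomial R)) (monomial s a)
        = Polynomial.C a * Polynomial.X ^ (s 0 + s 1) := by
      rw [monomial_eq_C_mul_pow_mul_pow]
      simp only [map_mul, map_pow, aeval_X, aeval_C, Polynomial.algebraMap_eq]
      ring
    rw [this, Polynomial.coeff_C_mul_X_pow]
    have key : ∀ p : ℕ × ℕ, (s 0 = p.1 ∧ s 1 = p.2) ↔ (s 0, s 1) = p := fun p => by
      rw [Prod.ext_iff]
    simp only [key, Finset.sum_ite_eq, Finset.HasAntidiagonal.mem_antidiagonal]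
    simp only [eq_comm]
  | add p q hp hq =>
    simp only [map_add, Polynomial.coeff_add, hp, hq, Finset.sum_add_distrib]

/-- A symmetric polynomial all of whose monomials `ξᵐηⁿ` have `|m - n| ≤ 1` is determined by its
restriction to the diagonal `ξ = η`. -/
theorem eq_zero_of_diagonal_eq_zero [IsDomain R] [CharZero R] (f : MvPolynomial (Fin 2) R)
    (hswap : rename (Equiv.swap 0 1) f = f)
    (hband : ∀ m n, m ≤ n → biCoeff m (n + 2) f = 0)
    (hdiag : aeval (fun _ => (Polynomial.X : Polynomial R)) f = 0) : f = 0 := by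
  have hsymm : ∀ m n, biCoeff m n f = biCoeff n m f := fun m n => by
    conv_lhs => rw [← hswap]
    exact biCoeff_rename_swap m n f
  have hoff : ∀ m n, m + 2 ≤ n → biCoeff m n f = 0 := fun m n h => by
    obtain ⟨c, rfl⟩ := Nat.exists_eq_add_of_le' (show 2 ≤ n by omega)
    exact hband m c (by omega)
  have hsum : ∀ k, ∑ p ∈ Finset.HasAntidiagonal.antidiagonal k, biCoeff p.1 p.2 f = 0 := fun k => by
    rw [← coeff_aeval_diagonal, hdiag, Polynomial.coeff_zero]
  have hle : ∀ m n, m ≤ n → biCoeff m n f = 0 := by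
    intro m n hmn
    rcases (show n = m ∨ n = m + 1 ∨ m + 2 ≤ n by omega) with rfl | rfl | h
    · rw [← hsum (n + n), Finset.sum_eq_single (n, n)]
      · rintro ⟨i, j⟩ hij hne
        rw [Finset.HasAntidiagonal.mem_antidiagonal] at hij
        rw [Ne, Prod.ext_iff] at hne
        dsimp only at hij hne ⊢
        rcases le_total i j with h | h
        · exact hoff i j (by omega)
        · rw [hsymm]
          exact hoff j i (by omega)
      · simp
    · have h2 := hsum (m + (m + 1))
      rw [Finset.sum_eq_add (m, m + 1) (m + 1, m) (by simp)] at h2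
      · dsimp only at h2
        rw [hsymm (m + 1) m, ← two_mul] at h2
        exact (mul_eq_zero.mp h2).resolve_left two_ne_zero
      · rintro ⟨i, j⟩ hij hne
        rw [Finset.HasAntidiagonal.mem_antidiagonal] at hij
        rw [Ne, Ne, Prod.ext_iff, Prod.ext_iff] at hne
        dsimp only at hij hne ⊢
        rcases le_total i j with h | h
        · exact hoff i j (by omega)
        · rw [hsymm]
          exact hoff j i (by omega)
      · simp
      · intro h
        exact absurd (Finset.HasAntidiagonal.mem_antidiagonal.mpr (by omega)) h
    · exact hoff m n h
  ext s
  rw [(single_add_single_eq_iff (s 0) (s 1) s).mpr ⟨rfl, rfl⟩, coeff_zero]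
  rcases le_total (s 0) (s 1) with h | h
  · exact hle _ _ h
  · exact (hsymm _ _).trans (hle _ _ h)

end BiCoeff

theorem bb_zero (g i : ℕ) : bb g i 0 = 0 := by
  simp [bb]

theorem bb_eq_zero_of_lt {g m : ℕ} (i : ℕ) (h : g < m) : bb g i m = 0 := by
  rw [bb, dif_neg (by omega)]

theorem Bcoef_coeff (g i m : ℕ) : (Bcoef g i).coeff m = bb g i m := by
  rw [Bcoef, Polynomial.finsetSum_coeff]
  simp only [Polynomial.coeff_C_mul_X_pow, Finset.sum_ite_eq, Finset.mem_Icc]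
  split_ifs with h
  · rfl
  · rcases (show m = 0 ∨ g < m by omega) with rfl | h
    · rw [bb_zero]
    · rw [bb_eq_zero_of_lt i h]

theorem Bcoef_natDegree_le (g i : ℕ) : (Bcoef g i).natDegree ≤ g :=
  Polynomial.natDegree_le_iff_coeff_eq_zero.mpr fun m hm => by
    rw [Bcoef_coeff, bb_eq_zero_of_lt i hm]

theorem BX_eq_aeval (g i : ℕ) : BX g i = Polynomial.aeval (X 0) (Bcoef g i) := by
  simp [BX, Bcoef, MvPolynomial.algebraMap_eq]

theorem BY_eq_aeval (g i : ℕ) : BY g i = Polynomial.aeval (X 1) (Bcoef g i) := by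
  simp [BY, Bcoef, MvPolynomial.algebraMap_eq]

theorem Qg_eq_zero_of_lt {g c : ℕ} (a : ℕ) (h : g < c) : Qg g a c = 0 := by
  have h1 : g < c + 1 := by omega
  have h2 : g < c + 2 := by omega
  match a with
  | 0 | 1 | 2 | 3 => simp [Qg, bb_eq_zero_of_lt, h, h1, h2]
  | a + 4 => simp [Qg, bb_eq_zero_of_lt, h, h1, not_le.mpr h1, not_le.mpr h2]

/-- The elimination recursion holds without truncation conditions. -/
theorem Qg_add_four (g a c : ℕ) :
    Qg g (a + 4) c = 2 * Qg g (a + 3) (c + 1) - Qg g (a + 2) (c + 2)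
      - 8 * bb g 1 1 * bb g 1 (a + 2) * bb g 1 c - 2 * bb g 1 c * bb g 1 (a + 3)
      - 2 * bb g 1 (a + 2) * bb g 1 (c + 1) + bb g 1 (a + 2) * bb g 3 c
      - bb g 2 (a + 2) * bb g 2 c + bb g 3 (a + 2) * bb g 1 c := by
  have h (a c : ℕ) : (if c ≤ g then Qg g a c else 0) = Qg g a c :=
    ite_eq_left_iff.mpr fun h => (Qg_eq_zero_of_lt a (not_le.mp h)).symm
  rw [Qg, h, h]

theorem pp_comm (g k l : ℕ) : pp g k l = pp g l k := by
  unfold pp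
  rcases lt_trichotomy k l with h | rfl | h
  · simp only [h.le, not_le.mpr h, if_true, if_false]
    congr 1
    exact propext (by tauto)
  · rfl
  · simp only [h.le, not_le.mpr h, if_true, if_false]
    congr 1
    exact propext (by tauto)

theorem pp_eq_zero {g i j : ℕ} (h : ¬((1 ≤ i ∧ i ≤ g) ∧ 1 ≤ j ∧ j ≤ g)) :
    pp g (2 * i - 1) (2 * j - 1) = 0 := by
  refine if_neg ?_
  rintro ⟨⟨_, _⟩, ⟨_, _⟩, _, _⟩
  omega

theorem pp_eq_Qg {g i j : ℕ} (h : i ≤ j) : pp g (2 * i - 1) (2 * j - 1) = Qg g i j := by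
  by_cases hi : i = 0
  · subst hi
    rw [pp_eq_zero (by omega), Qg]
  by_cases hj : g < j
  · rw [pp_eq_zero (by omega), Qg_eq_zero_of_lt _ hj]
  · rw [pp, if_pos ⟨⟨i - 1, by omega⟩, ⟨j - 1, by omega⟩, by omega, by omega⟩,
      if_pos (by omega)]
    congr 1 <;> omega

/-- The generating polynomial `Σ p_{2i−1,2j−1} ξⁱηʲ`. -/
def ppPoly (g : ℕ) : MvPolynomial (Fin 2) (Bg g) :=
  ∑ i ∈ Finset.Icc 1 g, ∑ j ∈ Finset.Icc 1 g, C (pp g (2 * i - 1) (2 * j - 1)) * X 0 ^ i * X 1 ^ j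

theorem biCoeff_ppPoly (g m n : ℕ) :
    biCoeff m n (ppPoly g) = pp g (2 * m - 1) (2 * n - 1) := by
  simp only [ppPoly, map_sum, biCoeff_C_mul_pow_mul_pow, ite_and, Finset.sum_ite_eq',
    Finset.sum_ite_irrel, Finset.sum_const_zero, Finset.mem_Icc]
  simp only [← ite_and]
  exact ite_eq_left_iff.mpr fun h => (pp_eq_zero (by tauto)).symm

theorem rename_swap_ppPoly (g : ℕ) : rename (Equiv.swap 0 1) (ppPoly g) = ppPoly g := by
  simp only [ppPoly, map_sum, map_mul, map_pow, rename_C, rename_X, Equiv.swap_apply_left,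
    Equiv.swap_apply_right]
  rw [Finset.sum_comm]
  refine Finset.sum_congr rfl fun i _ => Finset.sum_congr rfl fun j _ => ?_
  rw [pp_comm]
  ring

/-- The even part `Σ λ_{4i+2} ξⁱ⁺²ηⁱ⁺²` of the curve polynomial. -/
def lamEven (g : ℕ) : MvPolynomial (Fin 2) (Bg g) :=
  ∑ i ∈ Finset.Icc 1 g, C (lam g (2 * i)) * X 0 ^ (i + 2) * X 1 ^ (i + 2)

/-- The odd part `Σ λ_{4i+4} (ξ+η) ξⁱ⁺²ηⁱ⁺²` of the curve polynomial. -/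
def lamOdd (g : ℕ) : MvPolynomial (Fin 2) (Bg g) :=
  ∑ i ∈ Finset.range g, C (lam g (2 * i + 1)) * (X 0 + X 1) * X 0 ^ (i + 2) * X 1 ^ (i + 2)

theorem biCoeff_lamEven {m n : ℕ} (g : ℕ) (h : m ≤ n) : biCoeff m (n + 2) (lamEven g) = 0 := by
  simp only [lamEven, map_sum, biCoeff_C_mul_pow_mul_pow]
  exact Finset.sum_eq_zero fun i _ => if_neg (by omega)

theorem biCoeff_lamOdd {m n : ℕ} (g : ℕ) (h : m ≤ n) : biCoeff m (n + 2) (lamOdd g) = 0 := by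
  rw [lamOdd, map_sum]
  refine Finset.sum_eq_zero fun i _ => ?_
  have : C (lam g (2 * i + 1)) * (X 0 + X 1) * X 0 ^ (i + 2) * X 1 ^ (i + 2)
      = C (lam g (2 * i + 1)) * X 0 ^ (i + 3) * X 1 ^ (i + 2)
        + (C (lam g (2 * i + 1)) * X 0 ^ (i + 2) * X 1 ^ (i + 3) :
          MvPolynomial (Fin 2) (Bg g)) := by
    ring
  rw [this, map_add, biCoeff_C_mul_pow_mul_pow, biCoeff_C_mul_pow_mul_pow, if_neg (by omega),
    if_neg (by omega), add_zero]

theorem rename_swap_lamEven (g : ℕ) : rename (Equiv.swap 0 1) (lamEven g) = lamEven g := by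
  simp only [lamEven, map_sum, map_mul, map_pow, rename_C, rename_X, Equiv.swap_apply_left,
    Equiv.swap_apply_right]
  exact Finset.sum_congr rfl fun i _ => by ring

theorem rename_swap_lamOdd (g : ℕ) : rename (Equiv.swap 0 1) (lamOdd g) = lamOdd g := by
  simp only [lamOdd, map_sum, map_mul, map_add, map_pow, rename_C, rename_X,
    Equiv.swap_apply_left, Equiv.swap_apply_right]
  exact Finset.sum_congr rfl fun i _ => by ring

theorem four_mul_lam (g m : ℕ) : 4 * lam g m = (Fg g).coeff (m + 1) := by
  rw [lam, show (4 : Bg g) = C 4 from (map_ofNat C 4).symm, C_mul', smul_smul]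
  norm_num

theorem Fg_natDegree_le (g : ℕ) : (Fg g).natDegree ≤ 2 * g + 1 := by
  have h2 := Bcoef_natDegree_le g 2
  have h3 := Bcoef_natDegree_le g 3
  have h1 : (1 - Bcoef g 1).natDegree ≤ g := by
    have := Bcoef_natDegree_le g 1
    compute_degree
    exact max_le (Nat.zero_le g) this
  unfold Fg
  generalize 1 - Bcoef g 1 = U at h1 ⊢
  compute_degree
  all_goals omega

theorem Fg_coeff_zero (g : ℕ) : (Fg g).coeff 0 = 4 := by
  simp [Fg, Polynomial.coeff_zero_eq_eval_zero,
    show (Bcoef g 1).eval 0 = 0 by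
      rw [← Polynomial.coeff_zero_eq_eval_zero, Bcoef_coeff, bb_zero]]

theorem Fg_coeff_one (g : ℕ) : (Fg g).coeff 1 = 0 := by
  have h (i : ℕ) : Bcoef g i = Polynomial.X * (Bcoef g i).divX := by
    conv_lhs => rw [← Polynomial.X_mul_divX_add (Bcoef g i), Bcoef_coeff, bb_zero]
    simp
  set D : ℕ → Polynomial (Bg g) := fun i => (Bcoef g i).divX with hD
  have hF : Fg g = Polynomial.C 4 + Polynomial.X * (8 * (Polynomial.C (bb g 1 1) - D 1))
      + Polynomial.X ^ 2 * (Polynomial.X * D 2 ^ 2 + 2 * D 3 * (1 - Polynomial.X * D 1)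
        + 4 * D 1 ^ 2 + 8 * Polynomial.C (bb g 1 1) * (Polynomial.X * D 1 ^ 2 - 2 * D 1)) := by
    rw [Fg, h 1, h 2, h 3, map_ofNat]
    ring
  have h0 : (D 1).coeff 0 = bb g 1 1 := by
    rw [hD, Polynomial.coeff_divX, Bcoef_coeff]
  have h8 : (Polynomial.X * (8 * (Polynomial.C (bb g 1 1) - D 1))).coeff 1 = 0 := by
    refine (Polynomial.coeff_X_mul _ 0).trans ?_
    rw [Polynomial.mul_coeff_zero, Polynomial.coeff_sub, h0, Polynomial.coeff_C_zero, sub_self,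
      mul_zero]
  rw [hF, Polynomial.coeff_add, Polynomial.coeff_add, Polynomial.coeff_X_pow_mul', h8,
    if_neg (by norm_num), Polynomial.coeff_C_of_ne_zero one_ne_zero, add_zero, add_zero]

theorem sum_Icc_one_eq_sum_range {M : Type*} [AddCommMonoid M] (f : ℕ → M) (n : ℕ) :
    ∑ i ∈ Finset.Icc 1 n, f i = ∑ i ∈ Finset.range n, f (i + 1) := by
  induction n with
  | zero => simp
  | succ n ih => rw [Finset.sum_Icc_succ_top (by omega), ih, Finset.sum_range_succ]

theorem sum_range_two_mul {M : Type*} [AddCommMonoid M] (f : ℕ → M) (n : ℕ) :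
    ∑ i ∈ Finset.range (2 * n), f i = ∑ i ∈ Finset.range n, (f (2 * i) + f (2 * i + 1)) := by
  induction n with
  | zero => simp
  | succ n ih =>
    rw [Nat.mul_succ, Finset.sum_range_succ, Finset.sum_range_succ, ih, Finset.sum_range_succ,
      add_assoc]

theorem Fg_eq_sum_lam (g : ℕ) :
    Fg g = 4 + ∑ i ∈ Finset.range g,
      (Polynomial.C (4 * lam g (2 * i + 1)) * Polynomial.X ^ (2 * i + 2)
        + Polynomial.C (4 * lam g (2 * i + 2)) * Polynomial.X ^ (2 * i + 3)) := by
  conv_lhs => rw [(Fg g).as_sum_range_C_mul_X_pow' (n := 2 * (g + 1))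
    (by have := Fg_natDegree_le g; omega)]
  rw [sum_range_two_mul, Finset.sum_range_succ']
  refine (add_comm _ _).trans (congrArg₂ (· + ·) ?_ (Finset.sum_congr rfl fun i _ => ?_))
  · rw [mul_zero, zero_add, Fg_coeff_zero, Fg_coeff_one, map_ofNat, map_zero]
    simp
  · rw [four_mul_lam, four_mul_lam, show 2 * (i + 1) = 2 * i + 2 from rfl]

/-- Evaluation of a polynomial in `ξ, η` at `ξ = η`. -/
abbrev diagonal (g : ℕ) : MvPolynomial (Fin 2) (Bg g) →ₐ[Bg g] Polynomial (Bg g) :=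
  aeval fun _ => Polynomial.X

theorem diagonal_lam (g : ℕ) :
    4 * Polynomial.X ^ 3 + 4 * diagonal g (lamEven g) + 2 * diagonal g (lamOdd g)
      = Polynomial.X ^ 3 * Fg g := by
  have he : 4 * diagonal g (lamEven g) = Polynomial.X ^ 3 * ∑ i ∈ Finset.range g,
      Polynomial.C (4 * lam g (2 * i + 2)) * Polynomial.X ^ (2 * i + 3) := by
    rw [lamEven, sum_Icc_one_eq_sum_range, map_sum, Finset.mul_sum, Finset.mul_sum]
    refine Finset.sum_congr rfl fun i _ => ?_
    simp only [map_mul, map_pow, aeval_X, aeval_C, Polynomial.algebraMap_eq, map_ofNat, mul_add,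
      mul_one]
    ring
  have ho : 2 * diagonal g (lamOdd g) = Polynomial.X ^ 3 * ∑ i ∈ Finset.range g,
      Polynomial.C (4 * lam g (2 * i + 1)) * Polynomial.X ^ (2 * i + 2) := by
    rw [lamOdd, map_sum, Finset.mul_sum, Finset.mul_sum]
    refine Finset.sum_congr rfl fun i _ => ?_
    simp only [map_mul, map_add, map_pow, aeval_X, aeval_C, Polynomial.algebraMap_eq, map_ofNat]
    ring
  rw [Fg_eq_sum_lam, Finset.sum_add_distrib, he, ho]
  ring

theorem diagonal_BX (g i : ℕ) : diagonal g (BX g i) = Bcoef g i := by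
  simp [BX, Bcoef, Polynomial.algebraMap_eq]

theorem diagonal_BY (g i : ℕ) : diagonal g (BY g i) = Bcoef g i := by
  simp [BY, Bcoef, Polynomial.algebraMap_eq]

theorem rename_swap_BX (g i : ℕ) : rename (Equiv.swap 0 1) (BX g i) = BY g i := by
  simp [BX, BY]

theorem rename_swap_BY (g i : ℕ) : rename (Equiv.swap 0 1) (BY g i) = BX g i := by
  simp [BX, BY]

/-- The product `ξ²η² q(ξ,η)`. -/
def qPoly (g : ℕ) : MvPolynomial (Fin 2) (Bg g) :=
  X 0 ^ 2 * X 1 ^ 2 * (BX g 2 * BY g 2 + (1 - BX g 1) * BY g 3 + BX g 3 * (1 - BY g 1))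
    + 2 * (1 - BX g 1) * (1 - BY g 1)
      * (X 0 * X 1 ^ 2 + X 0 ^ 2 * X 1 + 4 * C (bb g 1 1) * X 0 ^ 2 * X 1 ^ 2)

/-- The coefficients of `1 - 𝐛₁(ξ)`. -/
theorem one_sub_Bcoef_coeff (g m : ℕ) :
    (1 - Bcoef g 1).coeff m = if m = 0 then 1 else -bb g 1 m := by
  rw [Polynomial.coeff_sub, Bcoef_coeff, Polynomial.coeff_one]
  split_ifs with h
  · rw [h, bb_zero, sub_zero]
  · rw [zero_sub]

/-- The elimination recursion for `p` is the coefficientwise form of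
`(ξ−η)² Σ p_{2i−1,2j−1} ξⁱηʲ = 2ξη² + 2ξ²η - ξ²η² q(ξ,η)` away from the diagonal. -/
theorem biCoeff_sq_mul_ppPoly {m n : ℕ} (g : ℕ) (h : m ≤ n) :
    biCoeff m (n + 2) ((X 0 - X 1) ^ 2 * ppPoly g)
      = biCoeff m (n + 2) (2 * X 0 * X 1 ^ 2 + 2 * X 0 ^ 2 * X 1 - qPoly g) := by
  have hl : (X 0 - X 1) ^ 2 * ppPoly g = X 0 ^ 2 * X 1 ^ 0 * ppPoly g
      - (2 : Bg g) • (X 0 ^ 1 * X 1 ^ 1 * ppPoly g) + X 0 ^ 0 * X 1 ^ 2 * ppPoly g := by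
    rw [smul_eq_C_mul, map_ofNat]
    ring
  have hr : 2 * X 0 * X 1 ^ 2 + 2 * X 0 ^ 2 * X 1 - qPoly g
      = C 2 * X 0 ^ 1 * X 1 ^ 2 + C 2 * X 0 ^ 2 * X 1 ^ 1
        - (X 0 ^ 2 * X 1 ^ 2 * (BX g 2 * BY g 2)
          + X 0 ^ 2 * X 1 ^ 2 * ((1 - BX g 1) * BY g 3)
          + X 0 ^ 2 * X 1 ^ 2 * (BX g 3 * (1 - BY g 1))
          + (2 : Bg g) • (X 0 ^ 1 * X 1 ^ 2 * ((1 - BX g 1) * (1 - BY g 1)))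
          + (2 : Bg g) • (X 0 ^ 2 * X 1 ^ 1 * ((1 - BX g 1) * (1 - BY g 1)))
          + (8 * bb g 1 1) • (X 0 ^ 2 * X 1 ^ 2 * ((1 - BX g 1) * (1 - BY g 1)))) := by
    simp only [qPoly, smul_eq_C_mul, map_mul, map_ofNat]
    ring
  have hX : 1 - BX g 1 = Polynomial.aeval (X 0) (1 - Bcoef g 1) := by
    rw [BX_eq_aeval, map_sub, map_one]
  have hY : 1 - BY g 1 = Polynomial.aeval (X 1) (1 - Bcoef g 1) := by
    rw [BY_eq_aeval, map_sub, map_one]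
  have hU := one_sub_Bcoef_coeff g
  rw [hl, hr, hX, hY, BX_eq_aeval, BX_eq_aeval, BY_eq_aeval, BY_eq_aeval]
  generalize 1 - Bcoef g 1 = U at hU ⊢
  simp only [map_add, map_sub, map_smul, biCoeff_pow_mul_pow_mul, biCoeff_C_mul_pow_mul_pow,
    biCoeff_aeval_mul_aeval, biCoeff_ppPoly, Bcoef_coeff, hU, smul_eq_mul]
  rw [pp_eq_Qg (show m - 0 ≤ n + 2 - 2 by omega),
    pp_eq_Qg (show m - 1 ≤ n + 2 - 1 by omega), pp_eq_Qg (show m - 2 ≤ n + 2 - 0 by omega)]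
  match m with
  | 0 => simp [Qg]
  | 1 =>
    have hn : n ≠ 0 := by omega
    simp [Qg, hn]
  | 2 =>
    have hn : n ≠ 0 := by omega
    simp [Qg, hn, bb_zero]
    ring
  | 3 =>
    have hn : n ≠ 0 := by omega
    simp [Qg, hn]
    ring
  | a + 4 =>
    have hn : n ≠ 0 := by omega
    simp [Qg_add_four, hn]
    ring

theorem rename_swap_qPoly (g : ℕ) : rename (Equiv.swap 0 1) (qPoly g) = qPoly g := by
  simp only [qPoly, map_add, map_sub, map_mul, map_pow, map_one, map_ofNat, rename_C, rename_X,
    Equiv.swap_apply_left, Equiv.swap_apply_right, rename_swap_BX, rename_swap_BY]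
  ring

theorem diagonal_qPoly (g : ℕ) : diagonal g (qPoly g) = Polynomial.X ^ 3 * Fg g := by
  simp only [qPoly, Fg, map_add, map_sub, map_mul, map_pow, map_one, map_ofNat, aeval_X, aeval_C,
    Polynomial.algebraMap_eq, diagonal_BX, diagonal_BY]
  ring

theorem addition_identity (g : ℕ) :
    2 * X 0 * X 1 ^ 2 + 2 * X 0 ^ 2 * X 1 + 4 * lamEven g + 2 * lamOdd g - qPoly g
      = (X 0 - X 1) ^ 2 * ppPoly g := by
  rw [← sub_eq_zero]
  apply eq_zero_of_diagonal_eq_zero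
  · simp only [map_add, map_sub, map_mul, map_pow, map_ofNat, rename_X, Equiv.swap_apply_left,
      Equiv.swap_apply_right, rename_swap_qPoly, rename_swap_lamEven, rename_swap_lamOdd,
      rename_swap_ppPoly]
    ring
  · intro m n h
    have : 2 * X 0 * X 1 ^ 2 + 2 * X 0 ^ 2 * X 1 + 4 * lamEven g + 2 * lamOdd g - qPoly g
        - (X 0 - X 1) ^ 2 * ppPoly g
        = (4 : Bg g) • lamEven g + (2 : Bg g) • lamOdd g
          + (2 * X 0 * X 1 ^ 2 + 2 * X 0 ^ 2 * X 1 - qPoly g)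
          - (X 0 - X 1) ^ 2 * ppPoly g := by
      simp only [smul_eq_C_mul, map_ofNat]
      ring
    rw [this, map_sub, map_add, map_add, map_smul, map_smul, biCoeff_lamEven g h,
      biCoeff_lamOdd g h, biCoeff_sq_mul_ppPoly g h]
    simp
  · have := diagonal_lam g
    simp only [map_add, map_sub, map_mul, map_pow, map_ofNat, aeval_X, diagonal_qPoly]
    linear_combination this

/-- the identity
ξ²η²(2ξ⁻¹ + 2η⁻¹ + 4Σ λ_{4i+2}ξⁱηⁱ + 2Σ λ_{4i+4}(ξ+η)ξⁱηⁱ − q(ξ,η))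
  = (ξ−η)²·Σ_{i,j=1}^{g} p_{2i−1,2j−1} ξⁱηʲ
in B_g[ξ,η] (with ξ²η²·q(ξ,η) multiplied out so that both sides are genuine
polynomials); in particular the coefficient of ξⁱη is p_{2i−1,1} = 2b_{1,2i−1}. -/
theorem stmt3 (g : ℕ) (hg : 1 ≤ g) :
    (2 * (MvPolynomial.X 0) * (MvPolynomial.X 1) ^ 2
      + 2 * (MvPolynomial.X 0) ^ 2 * (MvPolynomial.X 1)
      + 4 * ∑ i ∈ Finset.Icc 1 g, MvPolynomial.C (lam g (2 * i))
          * (MvPolynomial.X 0) ^ (i + 2) * (MvPolynomial.X 1) ^ (i + 2)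
      + 2 * ∑ i ∈ Finset.range g, MvPolynomial.C (lam g (2 * i + 1))
          * (MvPolynomial.X 0 + MvPolynomial.X 1)
          * (MvPolynomial.X 0) ^ (i + 2) * (MvPolynomial.X 1) ^ (i + 2)
      - ((MvPolynomial.X 0) ^ 2 * (MvPolynomial.X 1) ^ 2
            * (BX g 2 * BY g 2 + (1 - BX g 1) * BY g 3 + BX g 3 * (1 - BY g 1))
          + 2 * (1 - BX g 1) * (1 - BY g 1)
            * ((MvPolynomial.X 0) * (MvPolynomial.X 1) ^ 2
              + (MvPolynomial.X 0) ^ 2 * (MvPolynomial.X 1)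
              + 4 * MvPolynomial.C (bb g 1 1)
                  * (MvPolynomial.X 0) ^ 2 * (MvPolynomial.X 1) ^ 2))
      : MvPolynomial (Fin 2) (Bg g))
    = (MvPolynomial.X 0 - MvPolynomial.X 1) ^ 2
        * ∑ i ∈ Finset.Icc 1 g, ∑ j ∈ Finset.Icc 1 g,
            MvPolynomial.C (pp g (2 * i - 1) (2 * j - 1))
              * (MvPolynomial.X 0) ^ i * (MvPolynomial.X 1) ^ j ∧
    ∀ i, 1 ≤ i → i ≤ g → pp g (2 * i - 1) 1 = 2 * bv g 1 (2 * i - 1) := by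
  refine ⟨addition_identity g, fun i hi hig => ?_⟩
  have h := pp_eq_Qg (g := g) hi
  rw [pp_comm, h, Qg, bv, if_pos ⟨i - 1, by omega⟩]
  congr 2
  omega

end
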